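/- For every t with 1 ≤ t < m−1: Θ(A^t) = {x ∈ F^n : p^t(x) = 0}, and |Θ(A^t)| = 2^{2^{m−t}(2^t−1)}. -/

import Mathlib

open Finset Pointwise

abbrev Word (n : ℕ) := Fin n → ZMod 2

def FEv (n : ℕ) : Set (Word n) := {x | Even (hammingNorm x)}

def FOd (n : ℕ) : Set (Word n) := {x | ¬ Even (hammingNorm x)}

def nbr {n : ℕ} (S : Set (Word n)) : Set (Word n) := {y | ∃ x ∈ S, hammingDist y x = 1}

def theta {n : ℕ} (G : Set (Word n)) : Set (Word n) :=
  {x | Even (hammingNorm x) ∧ nbr {x} ⊆ nbr G}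

def ExtPerfect {n : ℕ} (C : Set (Word n)) : Prop :=
  C ⊆ FEv n ∧ (∀ x ∈ C, ∀ y ∈ C, x ≠ y → Disjoint (nbr {x}) (nbr {y})) ∧ nbr C = FOd n

def IsIsometry {n : ℕ} (g : Word n → Word n) : Prop :=
  Function.Bijective g ∧ ∀ x y, hammingDist (g x) (g y) = hammingDist x y

def embWord (m t : ℕ) (v : Word (2 ^ (m - t))) : Word (2 ^ m) := fun i =>
  if h : (i : ℕ) < 2 ^ (m - t) then v ⟨i, h⟩
  else if h2 : (i : ℕ) < 2 * 2 ^ (m - t) then v ⟨(i : ℕ) - 2 ^ (m - t), by omega⟩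
  else 0

def Vt (m t : ℕ) : Set (Word (2 ^ m)) :=
  {x | ∃ v : Word (2 ^ (m - t)), Even (hammingNorm v) ∧ x = embWord m t v}

def At (m : ℕ) : ℕ → Set (Word (2 ^ m))
  | 0 => {0}
  | 1 => Vt m 1
  | t + 2 => Vt m (t + 2) + At m (t + 1)

def IsComp (m t : ℕ) (G : Set (Word (2 ^ m))) : Prop :=
  G ⊆ FEv (2 ^ m) ∧ G.ncard = (At m t).ncard ∧ nbr G = nbr (At m t)

def IsMuComp (m t : ℕ) (μ : Word (2 ^ m)) (M : Set (Word (2 ^ m))) : Prop :=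
  (∀ i : Fin (2 ^ m), 2 ^ (m - t) ≤ (i : ℕ) → μ i = 0) ∧
  ∃ G, IsComp m t G ∧ M = (fun x => μ + x) '' G

def arrEntry (m t : ℕ) (x : Word (2 ^ m)) (i : Fin (2 ^ t)) (j : Fin (2 ^ (m - t))) : ZMod 2 :=
  x ⟨((i : ℕ) * 2 ^ (m - t) + (j : ℕ)) % 2 ^ m, Nat.mod_lt _ (Nat.two_pow_pos m)⟩

def pchk (m t : ℕ) (x : Word (2 ^ m)) : Word (2 ^ (m - t)) :=
  fun j => ∑ i : Fin (2 ^ t), arrEntry m t x i j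

def Bt (m : ℕ) : ℕ → Set (Word (2 ^ m))
  | 0 => Vt m 1
  | 1 => Vt m 1
  | t + 2 => Vt m (t + 2) + theta (At m (t + 1))

/-- The sum of the entries of `x` over the positions congruent to `j` modulo `L`. -/
def residueSum {n : ℕ} (L : ℕ) (x : Word n) (j : ℕ) : ZMod 2 :=
  ∑ k : Fin n, if (k : ℕ) % L = j then x k else 0

lemma residueSum_add {n : ℕ} (L : ℕ) (x y : Word n) (j : ℕ) :
    residueSum L (x + y) j = residueSum L x j + residueSum L y j := by
  simp only [residueSum, ← Finset.sum_add_distrib]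
  refine Finset.sum_congr rfl fun k _ => ?_
  split_ifs <;> simp

lemma residueSum_single {n : ℕ} (L : ℕ) (i : Fin n) (j : ℕ) :
    residueSum L (Pi.single i 1 : Word n) j = if (i : ℕ) % L = j then 1 else 0 := by
  rw [residueSum, Finset.sum_eq_single i]
  · simp
  · intro k _ hk
    simp [hk]
  · simp

lemma residueSum_two_mul {n L : ℕ} (x : Word n) {j : ℕ} (hj : j < L) :
    residueSum L x j = residueSum (2 * L) x j + residueSum (2 * L) x (j + L) := by
  simp only [residueSum, ← Finset.sum_add_distrib]
  refine Finset.sum_congr rfl fun k _ => ?_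
  have h1 : (k : ℕ) % (2 * L) % L = k % L := Nat.mod_mod_of_dvd _ (Dvd.intro_left 2 rfl)
  have h2 : (k : ℕ) % (2 * L) < 2 * L := Nat.mod_lt _ (by omega)
  generalize (k : ℕ) % (2 * L) = r at h1 h2
  rw [← h1]
  rcases lt_or_ge r L with h | h
  · rw [Nat.mod_eq_of_lt h, if_neg (show ¬ r = j + L by omega), add_zero]
  · rw [Nat.mod_eq_sub_mod h, Nat.mod_eq_of_lt (by omega), if_neg (show ¬ r = j by omega),
      zero_add]
    exact if_congr (by omega) rfl rfl

lemma residueSum_of_support {n L : ℕ} {x : Word n} (hx : ∀ k : Fin n, L ≤ (k : ℕ) → x k = 0)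
    {j : ℕ} (hj : j < L) (hjn : j < n) : residueSum L x j = x ⟨j, hjn⟩ := by
  rw [residueSum, Finset.sum_eq_single ⟨j, hjn⟩]
  · simp [Nat.mod_eq_of_lt hj]
  · intro k _ hk
    rcases lt_or_ge (k : ℕ) L with h | h
    · rw [Nat.mod_eq_of_lt h, if_neg]
      exact fun h' => hk (Fin.ext h')
    · simp [hx k h]
  · simp

lemma pchk_eq_residueSum {m t : ℕ} (ht : t ≤ m) (x : Word (2 ^ m)) (j : Fin (2 ^ (m - t))) :
    pchk m t x j = residueSum (2 ^ (m - t)) x j := by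
  have hmul : 2 ^ t * 2 ^ (m - t) = 2 ^ m := by rw [← pow_add]; congr 1; omega
  have hpos : 0 < 2 ^ (m - t) := by positivity
  have hlt (i : Fin (2 ^ t)) : (i : ℕ) * 2 ^ (m - t) + j < 2 ^ m := by
    have h := Nat.mul_le_mul_right (2 ^ (m - t)) (show (i : ℕ) + 1 ≤ 2 ^ t from i.2)
    rw [hmul, add_mul, one_mul] at h
    have := j.2
    omega
  simp only [pchk, arrEntry, residueSum, ← Finset.sum_filter]
  refine Finset.sum_bij (fun i _ => ⟨((i : ℕ) * 2 ^ (m - t) + j) % 2 ^ m,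
    Nat.mod_lt _ (Nat.two_pow_pos m)⟩) ?_ ?_ ?_ ?_
  · intro i _
    simp [Nat.mod_eq_of_lt (hlt i), Nat.mod_eq_of_lt j.2]
  · intro a _ b _ h
    simp only [Fin.mk.injEq, Nat.mod_eq_of_lt (hlt _)] at h
    exact Fin.ext (Nat.eq_of_mul_eq_mul_right hpos (by omega))
  · intro k hk
    have hk : (k : ℕ) % 2 ^ (m - t) = j := by simpa using hk
    refine ⟨⟨k / 2 ^ (m - t), ?_⟩, Finset.mem_univ _, Fin.ext ?_⟩
    · rw [Nat.div_lt_iff_lt_mul hpos, hmul]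
      exact k.2
    · simp only
      rw [← hk, mul_comm, Nat.div_add_mod, Nat.mod_eq_of_lt k.2]
  · intros
    rfl

lemma pchk_eq_zero_iff {m t : ℕ} (ht : t ≤ m) (x : Word (2 ^ m)) :
    pchk m t x = 0 ↔ ∀ j < 2 ^ (m - t), residueSum (2 ^ (m - t)) x j = 0 := by
  refine ⟨fun h j hj => ?_, fun h => funext fun j => ?_⟩
  · rw [← pchk_eq_residueSum ht x ⟨j, hj⟩, h, Pi.zero_apply]
  · rw [pchk_eq_residueSum ht, h _ j.2, Pi.zero_apply]

lemma even_hammingNorm_iff_sum {n : ℕ} (x : Word n) : Even (hammingNorm x) ↔ ∑ i, x i = 0 := by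
  rw [← ZMod.natCast_eq_zero_iff_even, hammingNorm, Finset.card_filter, Nat.cast_sum]
  have h (a : ZMod 2) : ((if a ≠ 0 then 1 else 0 : ℕ) : ZMod 2) = a := by
    revert a; decide
  simp only [h]

lemma hammingDist_eq_one_iff {n : ℕ} (y x : Word n) :
    hammingDist y x = 1 ↔ ∃ i, y = x + Pi.single i 1 := by
  have key (a b : ZMod 2) : a ≠ b ↔ a = b + 1 := by revert a b; decide
  rw [hammingDist, Finset.card_eq_one]
  refine exists_congr fun i => ?_
  simp only [Finset.ext_iff, Finset.mem_filter, Finset.mem_univ, true_and,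
    Finset.mem_singleton, funext_iff, Pi.add_apply]
  refine forall_congr' fun k => ?_
  by_cases hk : k = i
  · subst hk
    simp [key]
  · simp [hk]

lemma Word.add_self {n : ℕ} (x : Word n) : x + x = 0 :=
  funext fun k => CharTwo.add_self_eq_zero (x k)

lemma mem_theta_iff {n : ℕ} (G : Set (Word n)) (x : Word n) :
    x ∈ theta G ↔ Even (hammingNorm x) ∧
      ∀ i, ∃ j, x + Pi.single i 1 + Pi.single j 1 ∈ G := by
  refine and_congr_right fun _ => ?_
  simp only [nbr, Set.subset_def, Set.mem_ofPred_eq, Set.mem_singleton_iff, exists_eq_left,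
    hammingDist_eq_one_iff, forall_exists_index, forall_eq_apply_imp_iff]
  refine forall_congr' fun i => ⟨?_, ?_⟩
  · rintro ⟨a, ha, j, h⟩
    refine ⟨j, ?_⟩
    rwa [h, add_assoc, Word.add_self, add_zero]
  · rintro ⟨j, h⟩
    exact ⟨_, h, j, by rw [add_assoc _ (Pi.single j 1), Word.add_self, add_zero]⟩

lemma At_succ (m t : ℕ) : At m (t + 1) = Vt m (t + 1) + At m t := by
  cases t with
  | zero => simp [At]
  | succ t => rfl

lemma two_pow_sub_eq {m t : ℕ} (ht : t + 1 ≤ m) : 2 ^ (m - t) = 2 * 2 ^ (m - (t + 1)) := by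
  rw [← pow_succ']
  congr 1
  omega

lemma residueSum_embWord {m t : ℕ} (ht : t + 1 ≤ m) (v : Word (2 ^ (m - (t + 1)))) {j : ℕ}
    (hj : j < 2 * 2 ^ (m - (t + 1))) :
    residueSum (2 * 2 ^ (m - (t + 1))) (embWord m (t + 1) v) j =
      v ⟨j % 2 ^ (m - (t + 1)), Nat.mod_lt _ (by positivity)⟩ := by
  have hle : 2 * 2 ^ (m - (t + 1)) ≤ 2 ^ m := by
    rw [← two_pow_sub_eq ht]
    exact Nat.pow_le_pow_right (by norm_num) (by omega)
  rw [residueSum_of_support _ hj (hj.trans_le hle)]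
  · simp only [embWord]
    split_ifs with h
    · simp [Nat.mod_eq_of_lt h]
    · congr 2
      rw [Nat.mod_eq_sub_mod (by omega), Nat.mod_eq_of_lt (by omega)]
  · intro k hk
    simp only [embWord]
    rw [dif_neg (by omega), dif_neg (by omega)]

lemma residueSum_eq_zero_of_mem_At {m t : ℕ} (ht : t ≤ m) {a : Word (2 ^ m)} (ha : a ∈ At m t) :
    ∀ j < 2 ^ (m - t), residueSum (2 ^ (m - t)) a j = 0 := by
  induction t generalizing a with
  | zero =>
    rw [At, Set.mem_singleton_iff] at ha
    simp [ha, residueSum]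
  | succ t ih =>
    intro j hj
    rw [At_succ, Set.mem_add] at ha
    obtain ⟨_, ⟨v, -, rfl⟩, b, hb, rfl⟩ := ha
    have hb' := ih (by omega) hb
    rw [two_pow_sub_eq ht] at hb'
    rw [residueSum_add, residueSum_two_mul _ hj, residueSum_two_mul b hj,
      hb' j (by omega), hb' _ (by omega), residueSum_embWord ht v (by omega),
      residueSum_embWord ht v (by omega)]
    simp only [Nat.add_mod_right, add_zero]
    exact CharTwo.add_self_eq_zero _

lemma exists_partner {m t : ℕ} (ht : t + 1 ≤ m) (i : Fin (2 ^ m)) :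
    ∃ k : Fin (2 ^ m), (k : ℕ) % 2 ^ (m - (t + 1)) = i % 2 ^ (m - (t + 1)) ∧
      ((k : ℕ) % (2 * 2 ^ (m - (t + 1))) < 2 ^ (m - (t + 1)) ↔
        ¬ (i : ℕ) % (2 * 2 ^ (m - (t + 1))) < 2 ^ (m - (t + 1))) := by
  have hdvd : 2 * 2 ^ (m - (t + 1)) ∣ 2 ^ m := by
    rw [← two_pow_sub_eq ht]
    exact pow_dvd_pow 2 (by omega)
  have hpos : 0 < 2 ^ (m - (t + 1)) := by positivity
  obtain ⟨c, hc⟩ := hdvd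
  generalize 2 ^ (m - (t + 1)) = L at hc hpos
  have hr : (i : ℕ) % (2 * L) < 2 * L := Nat.mod_lt _ (by omega)
  have hi := Nat.div_add_mod (i : ℕ) (2 * L)
  have hq : (i : ℕ) / (2 * L) + 1 ≤ c := by
    have : (i : ℕ) / (2 * L) < c := by
      rw [Nat.div_lt_iff_lt_mul (by omega), mul_comm, ← hc]
      exact i.2
    omega
  have hqc := Nat.mul_le_mul_left (2 * L) hq
  rw [← hc, mul_add] at hqc
  generalize (i : ℕ) / (2 * L) = q at hi hq hqc
  generalize (i : ℕ) % (2 * L) = r at hi hr ⊢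
  rw [← hi]
  rcases lt_or_ge r L with h | h
  · refine ⟨⟨2 * L * q + (r + L), by omega⟩, ?_, ?_⟩
    · simp only
      rw [← add_assoc, Nat.add_mod_right]
    · simp only [Nat.mul_add_mod, Nat.mod_eq_of_lt (show r + L < 2 * L by omega)]
      omega
  · refine ⟨⟨2 * L * q + (r - L), by omega⟩, ?_, ?_⟩
    · obtain ⟨s, rfl⟩ := Nat.exists_eq_add_of_le' h
      simp only [Nat.add_sub_cancel]
      rw [← add_assoc, Nat.add_mod_right]
    · simp only [Nat.mul_add_mod, Nat.mod_eq_of_lt (show r - L < 2 * L by omega)]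
      omega

lemma exists_add_single_mem_At {m t : ℕ} (ht : t ≤ m) {x : Word (2 ^ m)}
    (hx : ∀ j < 2 ^ (m - t), residueSum (2 ^ (m - t)) x j = 0) (i : Fin (2 ^ m)) :
    ∃ j, x + Pi.single i 1 + Pi.single j 1 ∈ At m t := by
  induction t generalizing x i with
  | zero =>
    refine ⟨i, ?_⟩
    have : x = 0 := by
      funext k
      rw [Pi.zero_apply, ← hx k k.2]
      exact (residueSum_of_support (fun l hl => absurd l.2 (not_lt.mpr hl)) k.2 k.2).symm
    rw [this, zero_add, Word.add_self]
    rfl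
  | succ t ih =>
    obtain ⟨k, hk, hk'⟩ := exists_partner ht i
    have hpow := two_pow_sub_eq ht
    set L := 2 ^ (m - (t + 1)) with hL
    have hLpos : 0 < L := by positivity
    have even_case (y : Word (2 ^ m)) (hy : ∀ j < L, residueSum L y j = 0)
        (hsum : ∑ j ∈ Finset.range L, residueSum (2 * L) y j = 0) (i : Fin (2 ^ m)) :
        ∃ j, y + Pi.single i 1 + Pi.single j 1 ∈ At m (t + 1) := by
      let u : Word (2 ^ (m - (t + 1))) := fun j => residueSum (2 * L) y j
      have hyu : ∀ j < 2 ^ (m - t),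
          residueSum (2 ^ (m - t)) (embWord m (t + 1) u + y) j = 0 := by
        intro j hj
        rw [hpow] at hj ⊢
        rw [residueSum_add, residueSum_embWord ht u hj]
        change residueSum (2 * L) y (j % L) + _ = 0
        rcases lt_or_ge j L with h | h
        · rw [Nat.mod_eq_of_lt h, CharTwo.add_self_eq_zero]
        · rw [Nat.mod_eq_sub_mod h, Nat.mod_eq_of_lt (by omega)]
          have := hy (j - L) (by omega)
          rwa [residueSum_two_mul _ (by omega), Nat.sub_add_cancel h] at this
      obtain ⟨j, hj⟩ := ih (by omega) hyu i
      refine ⟨j, ?_⟩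
      rw [At_succ, Set.mem_add]
      refine ⟨embWord m (t + 1) u, ⟨u, ?_, rfl⟩, _, hj, ?_⟩
      · rw [even_hammingNorm_iff_sum,
          Fin.sum_univ_eq_sum_range (fun j => residueSum (2 * L) y j)]
        exact hsum
      · simp only [← add_assoc, Word.add_self, zero_add]
    by_cases hsum : ∑ j ∈ Finset.range L, residueSum (2 * L) x j = 0
    · exact even_case x hx hsum i
    have hsum : ∑ j ∈ Finset.range L, residueSum (2 * L) x j = 1 := by
      revert hsum
      generalize ∑ j ∈ Finset.range L, residueSum (2 * L) x j = a
      revert a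
      decide
    obtain ⟨j, hj⟩ := even_case (x + Pi.single i 1 + Pi.single k 1) (fun j hj => by
        rw [residueSum_add, residueSum_add, hx j hj, residueSum_single, residueSum_single, hk,
          zero_add, CharTwo.add_self_eq_zero]) (by
        simp only [residueSum_add, residueSum_single, Finset.sum_add_distrib, hsum,
          Finset.sum_ite_eq, Finset.mem_range, hk']
        by_cases h : (i : ℕ) % (2 * L) < L
        · simp only [h, if_true, not_true, if_false]
          decide
        · simp only [h, if_true, not_false_iff, if_false]
          decide) k
    refine ⟨j, ?_⟩
    rwa [add_assoc (x + Pi.single i 1), Word.add_self, add_zero] at hj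

lemma even_hammingNorm_of_residueSum_eq_zero {n L : ℕ} (hL : 0 < L) {x : Word n}
    (hx : ∀ j < L, residueSum L x j = 0) : Even (hammingNorm x) := by
  rw [even_hammingNorm_iff_sum]
  calc ∑ k, x k = ∑ k : Fin n, ∑ j ∈ Finset.range L, if (k : ℕ) % L = j then x k else 0 := by
        refine Finset.sum_congr rfl fun k _ => ?_
        rw [Finset.sum_ite_eq, if_pos (Finset.mem_range.2 (Nat.mod_lt _ hL))]
    _ = ∑ j ∈ Finset.range L, residueSum L x j := Finset.sum_comm
    _ = 0 := Finset.sum_eq_zero fun j hj => hx j (Finset.mem_range.1 hj)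

lemma residueSum_eq_zero_of_mem_theta {m t : ℕ} (ht : t + 2 ≤ m) {x : Word (2 ^ m)}
    (hx : x ∈ theta (At m t)) : ∀ j < 2 ^ (m - t), residueSum (2 ^ (m - t)) x j = 0 := by
  have hL : 4 ≤ 2 ^ (m - t) := by
    calc 4 = 2 ^ 2 := by norm_num
      _ ≤ 2 ^ (m - t) := Nat.pow_le_pow_right (by norm_num) (by omega)
  have hle : 2 ^ (m - t) ≤ 2 ^ m := Nat.pow_le_pow_right (by norm_num) (by omega)
  have key : ∀ i < 2 ^ (m - t), ∃ r, ∀ j < 2 ^ (m - t),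
      residueSum (2 ^ (m - t)) x j = (if i = j then 1 else 0) + if r = j then 1 else 0 := by
    intro i hi
    obtain ⟨k, hk⟩ := ((mem_theta_iff _ _).1 hx).2 ⟨i, hi.trans_le hle⟩
    refine ⟨k % 2 ^ (m - t), fun j hj => ?_⟩
    have h := residueSum_eq_zero_of_mem_At (by omega) hk j hj
    rw [residueSum_add, residueSum_add, residueSum_single, residueSum_single, add_assoc] at h
    simp only [Nat.mod_eq_of_lt hi] at h
    exact CharTwo.add_eq_zero.1 h
  intro j hj
  by_contra hne
  obtain ⟨r, hr⟩ := key j hj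
  obtain ⟨i, hi, hij, hir⟩ : ∃ i < 2 ^ (m - t), i ≠ j ∧ i ≠ r := by
    by_contra! h
    have h0 := h 0 (by omega)
    have h1 := h 1 (by omega)
    have h2 := h 2 (by omega)
    omega
  obtain ⟨s, hs⟩ := key i hi
  have hi0 := hr i hi
  rw [if_neg hij.symm, if_neg hir.symm, hs i hi, if_pos rfl] at hi0
  have hsi : s = i := by
    by_contra h
    simp [h] at hi0
  apply hne
  rw [hs j hj, hsi, CharTwo.add_self_eq_zero]

/-- The generalized parity check as a linear map. -/
def pchkLinearMap (m t : ℕ) : Word (2 ^ m) →ₗ[ZMod 2] Word (2 ^ (m - t)) where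
  toFun := pchk m t
  map_add' x y := by
    funext j
    simp [pchk, arrEntry, Finset.sum_add_distrib]
  map_smul' c x := by
    funext j
    simp [pchk, arrEntry, Finset.mul_sum]

lemma pchkLinearMap_surjective {m t : ℕ} (ht : t ≤ m) :
    Function.Surjective (pchkLinearMap m t) := by
  intro v
  have hle : 2 ^ (m - t) ≤ 2 ^ m := Nat.pow_le_pow_right (by norm_num) (by omega)
  refine ⟨fun k => if h : (k : ℕ) < 2 ^ (m - t) then v ⟨k, h⟩ else 0, funext fun j => ?_⟩
  refine (pchk_eq_residueSum ht _ j).trans ?_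
  rw [residueSum_of_support _ j.2 (j.2.trans_le hle)]
  · simp
  · intro k hk
    rw [dif_neg (by omega)]

lemma ncard_pchk_eq_zero {m t : ℕ} (ht : t ≤ m) :
    {x : Word (2 ^ m) | pchk m t x = 0}.ncard = 2 ^ (2 ^ (m - t) * (2 ^ t - 1)) := by
  have hrank := (pchkLinearMap m t).finrank_range_add_finrank_ker
  rw [LinearMap.range_eq_top.2 (pchkLinearMap_surjective ht), finrank_top,
    Module.finrank_fin_fun, Module.finrank_fin_fun] at hrank
  have hmul : 2 ^ (m - t) * 2 ^ t = 2 ^ m := by rw [← pow_add]; congr 1; omega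
  have hker : Module.finrank (ZMod 2) (LinearMap.ker (pchkLinearMap m t)) =
      2 ^ (m - t) * (2 ^ t - 1) := by
    rw [Nat.mul_sub, mul_one, hmul]
    omega
  change Nat.card (LinearMap.ker (pchkLinearMap m t)) = _
  rw [Module.natCard_eq_pow_finrank (K := ZMod 2), hker, Nat.card_zmod]

/-- for 1 ≤ t < m-1, Θ(A^t) = {x : p^t(x) = 0} and |Θ(A^t)| = 2^{2^{m-t}(2^t-1)}. -/
theorem stmt_7 (m t : ℕ) (hm : 4 ≤ m) (ht : 1 ≤ t) (ht' : t < m - 1) :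
    theta (At m t) = {x : Word (2 ^ m) | pchk m t x = 0} ∧
    (theta (At m t)).ncard = 2 ^ (2 ^ (m - t) * (2 ^ t - 1)) := by
  have heq : theta (At m t) = {x : Word (2 ^ m) | pchk m t x = 0} := by
    ext x
    rw [Set.mem_ofPred_eq, pchk_eq_zero_iff (by omega)]
    refine ⟨residueSum_eq_zero_of_mem_theta (by omega), fun h => (mem_theta_iff _ _).2
      ⟨even_hammingNorm_of_residueSum_eq_zero (by positivity) h,
        exists_add_single_mem_At (by omega) h⟩⟩
  exact ⟨heq, by rw [heq, ncard_pchk_eq_zero (by omega)]⟩
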